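/- Run IR-PRM⁺ on the simplex Δ(n) with utilities u^(t) and predictions m^(t). Then the regret satisfies Reg^(T) ≤ √(‖r̃^(1)‖₂² + Σ_{t=1}^T ‖g^(t)‖₂²) − (1/(2n)) Σ_{t=1}^T ‖r̃^(t)‖₂ ‖x^(t) − x̃^(t)‖₂². -/

import Mathlib

open Matrix

/-- ℓ₂ norm of a vector in ℝ^d. -/
noncomputable def l2 {d : ℕ} (v : Fin d → ℝ) : ℝ := Real.sqrt (∑ i, (v i) ^ 2)

/-- ℓ₁ norm of a vector in ℝ^d. -/
def l1 {d : ℕ} (v : Fin d → ℝ) : ℝ := ∑ i, |v i|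

/-- Standard inner product on ℝ^d. -/
def dotp {d : ℕ} (v w : Fin d → ℝ) : ℝ := ∑ i, v i * w i

/-- Coordinatewise positive part `[v]⁺`. -/
def ppart {d : ℕ} (v : Fin d → ℝ) : Fin d → ℝ := fun i => max (v i) 0

/-- A run of the IR-PRM⁺ algorithm on the simplex `Δ(n)`, with utilities `u`,
predictions `m`, regret vectors `rt` (`r̃`) and `r`, normalization constants
`gam` (`γ`), and strategies `x`, `xt` (`x̃`); `g` is the shifted utility
increment.  All quantities are indexed starting from time `1`. -/
structure IRPRMp (n : ℕ) where
  u : ℕ → Fin n → ℝ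
  m : ℕ → Fin n → ℝ
  rt : ℕ → Fin n → ℝ
  gam : ℕ → ℝ
  r : ℕ → Fin n → ℝ
  x : ℕ → Fin n → ℝ
  xt : ℕ → Fin n → ℝ
  g : ℕ → Fin n → ℝ
  rt1_nonneg : ∀ i, 0 ≤ rt 1 i
  xt1_mem : rt 1 = 0 → xt 1 ∈ stdSimplex ℝ (Fin n)
  xt1_eq : rt 1 ≠ 0 → xt 1 = (l1 (rt 1))⁻¹ • rt 1
  zero_case : ∀ t, 1 ≤ t → rt t = 0 →
      m t = 0 ∧ gam t = 0 ∧ r t = 0 ∧ x t = xt t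
  gam_spec : ∀ t, 1 ≤ t → rt t ≠ 0 →
      l2 (ppart (rt t + m t - gam t • (1 : Fin n → ℝ))) = l2 (rt t)
  r_def : ∀ t, 1 ≤ t → rt t ≠ 0 →
      r t = rt t + m t - gam t • (1 : Fin n → ℝ)
  x_def : ∀ t, 1 ≤ t → rt t ≠ 0 →
      x t = (l1 (ppart (r t)))⁻¹ • ppart (r t)
  g_def : ∀ t, 1 ≤ t →
      g t = u t - m t - (dotp (u t - m t) (x t)) • (1 : Fin n → ℝ)
  rt_succ : ∀ t, 1 ≤ t → rt (t + 1) = ppart (r t + g t)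
  xt_succ_ne : ∀ t, 1 ≤ t → rt (t + 1) ≠ 0 →
      xt (t + 1) = (l1 (rt (t + 1)))⁻¹ • rt (t + 1)
  xt_succ_zero : ∀ t, 1 ≤ t → rt (t + 1) = 0 → xt (t + 1) = x t

theorem l2_sq {d : ℕ} (v : Fin d → ℝ) : l2 v ^ 2 = ∑ i, v i ^ 2 :=
  Real.sq_sqrt (Finset.sum_nonneg fun _ _ => sq_nonneg _)

theorem l2_le_sum {d : ℕ} {v : Fin d → ℝ} (hv : ∀ i, 0 ≤ v i) : l2 v ≤ ∑ i, v i := by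
  refine abs_le_of_sq_le_sq' ?_ (Finset.sum_nonneg fun i _ => hv i) |>.2
  rw [l2_sq]
  exact Finset.sum_sq_le_sq_sum_of_nonneg fun i _ => hv i

theorem l2_pos_of_ne_zero {d : ℕ} {v : Fin d → ℝ} (hv : v ≠ 0) : 0 < l2 v := by
  obtain ⟨i, hi⟩ := Function.ne_iff.mp hv
  exact Real.sqrt_pos.mpr (Finset.sum_pos' (fun _ _ => sq_nonneg _)
    ⟨i, Finset.mem_univ i, sq_pos_of_ne_zero hi⟩)

theorem l1_eq_sum {d : ℕ} {v : Fin d → ℝ} (hv : ∀ i, 0 ≤ v i) : l1 v = ∑ i, v i :=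
  Finset.sum_congr rfl fun i _ => abs_of_nonneg (hv i)

theorem ppart_nonneg {d : ℕ} (v : Fin d → ℝ) (i : Fin d) : 0 ≤ ppart v i := le_max_right _ _

/-- The oblique projection `d ↦ d - (∑ d) • y` along a vector `y` of coordinate sum one has
operator norm at most `√n ‖y‖₂`. -/
theorem sum_sq_sub_sum_mul_le {n : ℕ} (hn : 0 < n) (d y : Fin n → ℝ) (hy : ∑ i, y i = 1) :
    ∑ i, (d i - (∑ j, d j) * y i) ^ 2 ≤ n * (∑ i, y i ^ 2) * ∑ i, d i ^ 2 := by
  have hn' : (0 : ℝ) < n := by exact_mod_cast hn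
  set σ := ∑ j, d j with hσ
  set Y := ∑ i, y i ^ 2 with hY
  set D := ∑ i, d i ^ 2 with hD
  set c := ∑ i, d i * y i with hc
  have expand : ∑ i, (d i - σ * y i) ^ 2 = D - 2 * σ * c + σ ^ 2 * Y := by
    simp only [hD, hc, hY, Finset.mul_sum _ _ (2 * σ), Finset.mul_sum _ _ (σ ^ 2),
      ← Finset.sum_sub_distrib, ← Finset.sum_add_distrib]
    exact Finset.sum_congr rfl fun i _ => by ring
  have cauchy := Finset.sum_mul_sq_le_sq_mul_sq Finset.univ
    (fun i => n * d i - σ) (fun i => n * y i - 1)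
  have e1 : ∑ i, (n * d i - σ) * (n * y i - 1) = n * (n * c - σ) := by
    have : ∀ i, (n * d i - σ) * (n * y i - 1) = n ^ 2 * (d i * y i) - n * d i - n * σ * y i + σ :=
      fun i => by ring
    simp only [this, Finset.sum_add_distrib, Finset.sum_sub_distrib, ← Finset.mul_sum, hy, ← hσ,
      ← hc, Finset.sum_const, Finset.card_univ, Fintype.card_fin, nsmul_eq_mul]
    ring
  have e2 : ∑ i, (n * d i - σ) ^ 2 = n * (n * D - σ ^ 2) := by
    have : ∀ i, (n * d i - σ) ^ 2 = n ^ 2 * (d i) ^ 2 - 2 * n * σ * d i + σ ^ 2 :=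
      fun i => by ring
    simp only [this, Finset.sum_add_distrib, Finset.sum_sub_distrib, ← Finset.mul_sum, ← hσ,
      ← hD, Finset.sum_const, Finset.card_univ, Fintype.card_fin, nsmul_eq_mul]
    ring
  have e3 : ∑ i, (n * y i - 1) ^ 2 = n * (n * Y - 1) := by
    have : ∀ i, (n * y i - 1) ^ 2 = n ^ 2 * (y i) ^ 2 - 2 * n * y i + 1 :=
      fun i => by ring
    simp only [this, Finset.sum_add_distrib, Finset.sum_sub_distrib, ← Finset.mul_sum, hy,
      ← hY, Finset.sum_const, Finset.card_univ, Fintype.card_fin, nsmul_eq_mul]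
    ring
  rw [e1, e2, e3] at cauchy
  have hP : 0 ≤ n * D - σ ^ 2 :=
    nonneg_of_mul_nonneg_right (e2 ▸ Finset.sum_nonneg fun i _ => sq_nonneg (n * d i - σ)) hn'
  have hQ : 0 ≤ n * Y - 1 :=
    nonneg_of_mul_nonneg_right (e3 ▸ Finset.sum_nonneg fun i _ => sq_nonneg (n * y i - 1)) hn'
  have hk : (n * c - σ) ^ 2 ≤ (n * D - σ ^ 2) * (n * Y - 1) := by
    have : 0 < (n : ℝ) ^ 2 := by positivity
    nlinarith
  rw [expand]
  have key : -(2 * σ * (n * c - σ)) ≤ (n * D - σ ^ 2) * (n * Y - 1) + σ ^ 2 := by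
    nlinarith [sq_nonneg (n * c - σ + σ)]
  have : n * (D - 2 * σ * c + σ ^ 2 * Y) ≤ n * (n * Y * D) := by
    nlinarith
  exact le_of_mul_le_mul_left this hn'

/-- Normalizing two nonnegative vectors of equal Euclidean norm to the simplex. -/
theorem l2_normalize_sub_le {n : ℕ} (hn : 0 < n) {p q x y : Fin n → ℝ} {a b : ℝ}
    (hp : ∀ i, 0 ≤ p i) (hq : ∀ i, 0 ≤ q i) (ha : 0 < a) (hb : 0 < b)
    (hpa : ∑ i, p i = a) (hqb : ∑ i, q i = b)
    (hx : ∀ i, p i = a * x i) (hy : ∀ i, q i = b * y i) (hpq : l2 p = l2 q) :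
    1 / (2 * (n : ℝ)) * (l2 q * l2 (x - y) ^ 2) ≤ ∑ i, x i * (p i - q i) := by
  have hn' : (0 : ℝ) < n := by exact_mod_cast hn
  have hy1 : ∑ i, y i = 1 := by
    have : b * ∑ i, y i = b := by
      rw [Finset.mul_sum, ← hqb]
      exact Finset.sum_congr rfl fun i _ => by rw [hy, hqb]
    exact mul_left_cancel₀ hb.ne' (by linarith)
  have hy0 : ∀ i, 0 ≤ y i := fun i => nonneg_of_mul_nonneg_right (hy i ▸ hq i) hb
  have hy2 : ∑ i, y i ^ 2 ≤ 1 := by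
    calc ∑ i, y i ^ 2 ≤ (∑ i, y i) ^ 2 := Finset.sum_sq_le_sq_sum_of_nonneg fun i _ => hy0 i
      _ = 1 := by rw [hy1, one_pow]
  have hD : 0 ≤ ∑ i, (p i - q i) ^ 2 := Finset.sum_nonneg fun i _ => sq_nonneg _
  have proj := sum_sq_sub_sum_mul_le hn (fun i => p i - q i) y hy1
  have e : ∑ i, ((p i - q i) - (∑ j, (p j - q j)) * y i) ^ 2 = a ^ 2 * l2 (x - y) ^ 2 := by
    rw [Finset.sum_sub_distrib, hpa, hqb, l2_sq, Finset.mul_sum]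
    exact Finset.sum_congr rfl fun i _ => by rw [hx, hy, Pi.sub_apply]; ring
  simp only [e] at proj
  have proj' : a ^ 2 * l2 (x - y) ^ 2 ≤ n * ∑ i, (p i - q i) ^ 2 := by
    refine proj.trans (mul_le_mul_of_nonneg_right ?_ hD)
    nlinarith
  have hR : l2 q ≤ a := by rw [← hpq, ← hpa]; exact l2_le_sum hp
  have polar : a * ∑ i, x i * (p i - q i) = (∑ i, (p i - q i) ^ 2) / 2 := by
    have hs : ∑ i, p i ^ 2 = ∑ i, q i ^ 2 := by rw [← l2_sq, ← l2_sq, hpq]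
    have : ∑ i, (p i - q i) ^ 2
        = 2 * (a * ∑ i, x i * (p i - q i)) - (∑ i, p i ^ 2 - ∑ i, q i ^ 2) := by
      rw [← Finset.sum_sub_distrib, Finset.mul_sum, Finset.mul_sum, ← Finset.sum_sub_distrib]
      exact Finset.sum_congr rfl fun i _ => by rw [hx]; ring
    linarith
  have h1 : a * (l2 q * l2 (x - y) ^ 2) ≤ a ^ 2 * l2 (x - y) ^ 2 := by
    have := mul_le_mul_of_nonneg_right hR (mul_nonneg ha.le (sq_nonneg (l2 (x - y))))
    nlinarith
  have h2 : a * (l2 q * l2 (x - y) ^ 2) ≤ a * (2 * n * ∑ i, x i * (p i - q i)) := by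
    have : a * (2 * n * ∑ i, x i * (p i - q i)) = n * (2 * (a * ∑ i, x i * (p i - q i))) := by
      ring
    rw [this, polar]
    linarith
  have h3 := le_of_mul_le_mul_left h2 ha
  rw [one_div, inv_mul_le_iff₀ (by positivity)]
  exact h3

namespace IRPRMp

variable {n : ℕ} (alg : IRPRMp n)

theorem rt_nonneg {t : ℕ} (ht : 1 ≤ t) (i : Fin n) : 0 ≤ alg.rt t i := by
  induction t, ht using Nat.le_induction with
  | base => exact alg.rt1_nonneg i
  | succ t ht _ => rw [alg.rt_succ t ht]; exact ppart_nonneg _ i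

theorem l2_ppart_r {t : ℕ} (ht : 1 ≤ t) : l2 (ppart (alg.r t)) = l2 (alg.rt t) := by
  by_cases h : alg.rt t = 0
  · rw [(alg.zero_case t ht h).2.2.1, h]
    congr 1
    ext i
    simp [ppart]
  · rw [alg.r_def t ht h, alg.gam_spec t ht h]

theorem sum_rt_pos {t : ℕ} (ht : 1 ≤ t) (h : alg.rt t ≠ 0) : 0 < ∑ i, alg.rt t i :=
  (l2_pos_of_ne_zero h).trans_le (l2_le_sum (alg.rt_nonneg ht))

theorem sum_ppart_r_pos {t : ℕ} (ht : 1 ≤ t) (h : alg.rt t ≠ 0) :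
    0 < ∑ i, ppart (alg.r t) i :=
  (alg.l2_ppart_r ht ▸ l2_pos_of_ne_zero h).trans_le (l2_le_sum (ppart_nonneg _))

theorem ppart_r_eq {t : ℕ} (ht : 1 ≤ t) (h : alg.rt t ≠ 0) (i : Fin n) :
    ppart (alg.r t) i = (∑ j, ppart (alg.r t) j) * alg.x t i := by
  rw [alg.x_def t ht h, Pi.smul_apply, smul_eq_mul, l1_eq_sum (ppart_nonneg _),
    mul_inv_cancel_left₀ (alg.sum_ppart_r_pos ht h).ne']

theorem rt_eq {t : ℕ} (ht : 1 ≤ t) (h : alg.rt t ≠ 0) (i : Fin n) :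
    alg.rt t i = (∑ j, alg.rt t j) * alg.xt t i := by
  have : alg.xt t = (l1 (alg.rt t))⁻¹ • alg.rt t := by
    obtain rfl | ⟨s, hs, rfl⟩ : t = 1 ∨ ∃ s, 1 ≤ s ∧ t = s + 1 := by
      rcases Nat.lt_or_ge 1 t with h1 | h1
      · exact Or.inr ⟨t - 1, by omega, by omega⟩
      · exact Or.inl (by omega)
    · exact alg.xt1_eq h
    · exact alg.xt_succ_ne s hs h
  rw [this, Pi.smul_apply, smul_eq_mul, l1_eq_sum (alg.rt_nonneg ht),
    mul_inv_cancel_left₀ (alg.sum_rt_pos ht h).ne']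

theorem sum_x {t : ℕ} (ht : 1 ≤ t) : ∑ i, alg.x t i = 1 := by
  have ne_case : ∀ t, 1 ≤ t → alg.rt t ≠ 0 → ∑ i, alg.x t i = 1 := fun t ht h => by
    have e : ∑ i, ppart (alg.r t) i = (∑ j, ppart (alg.r t) j) * ∑ i, alg.x t i := by
      rw [Finset.mul_sum]
      exact Finset.sum_congr rfl fun i _ => alg.ppart_r_eq ht h i
    exact mul_left_cancel₀ (alg.sum_ppart_r_pos ht h).ne' (by linarith)
  induction t, ht using Nat.le_induction with
  | base =>
    by_cases h : alg.rt 1 = 0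
    · rw [(alg.zero_case 1 le_rfl h).2.2.2]
      exact (alg.xt1_mem h).2
    · exact ne_case 1 le_rfl h
  | succ t ht ih =>
    by_cases h : alg.rt (t + 1) = 0
    · rw [(alg.zero_case (t + 1) (by omega) h).2.2.2, alg.xt_succ_zero t ht h, ih]
    · exact ne_case (t + 1) (by omega) h

theorem dotp_g {t : ℕ} (ht : 1 ≤ t) {y : Fin n → ℝ} (hy : ∑ i, y i = 1) :
    dotp y (alg.g t) = dotp (y - alg.x t) (alg.u t - alg.m t) := by
  have : ∀ i, y i * alg.g t i = (y i - alg.x t i) * (alg.u t i - alg.m t i)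
      + (alg.u t i - alg.m t i) * alg.x t i - dotp (alg.u t - alg.m t) (alg.x t) * y i :=
    fun i => by
      rw [alg.g_def t ht]
      simp only [Pi.sub_apply, Pi.smul_apply, Pi.one_apply, smul_eq_mul]
      ring
  simp only [dotp] at this ⊢
  simp only [this, Finset.sum_sub_distrib, Finset.sum_add_distrib, ← Finset.mul_sum, hy,
    Pi.sub_apply]
  ring

theorem dotp_x_g {t : ℕ} (ht : 1 ≤ t) : dotp (alg.x t) (alg.g t) = 0 := by
  rw [alg.dotp_g ht (alg.sum_x ht)]
  simp [dotp]

theorem sum_ppart_r_mul_g {t : ℕ} (ht : 1 ≤ t) :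
    ∑ i, ppart (alg.r t) i * alg.g t i = 0 := by
  by_cases h : alg.rt t = 0
  · rw [(alg.zero_case t ht h).2.2.1]
    simp [ppart]
  · have e : ∑ i, ppart (alg.r t) i * alg.g t i
        = (∑ j, ppart (alg.r t) j) * dotp (alg.x t) (alg.g t) := by
      rw [dotp, Finset.mul_sum]
      exact Finset.sum_congr rfl fun i _ => by rw [alg.ppart_r_eq ht h i, mul_assoc]
    rw [e, alg.dotp_x_g ht, mul_zero]

theorem l2_rt_succ_sq_le {t : ℕ} (ht : 1 ≤ t) :
    l2 (alg.rt (t + 1)) ^ 2 ≤ l2 (alg.rt t) ^ 2 + l2 (alg.g t) ^ 2 := by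
  have h : l2 (alg.rt (t + 1)) ^ 2 ≤ ∑ i, (ppart (alg.r t) i + alg.g t i) ^ 2 := by
    rw [l2_sq, alg.rt_succ t ht]
    refine Finset.sum_le_sum fun i _ => ?_
    simp only [ppart, Pi.add_apply]
    rcases le_total (alg.r t i + alg.g t i) 0 with h | h
    · rw [max_eq_right h]
      nlinarith [sq_nonneg (max (alg.r t i) 0 + alg.g t i)]
    · rw [max_eq_left h]
      exact pow_le_pow_left₀ h (add_le_add_left (le_max_left _ _) _) 2
  have e : ∑ i, (ppart (alg.r t) i + alg.g t i) ^ 2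
      = l2 (alg.rt t) ^ 2 + l2 (alg.g t) ^ 2 + 2 * ∑ i, ppart (alg.r t) i * alg.g t i := by
    rw [← alg.l2_ppart_r ht, l2_sq, l2_sq, Finset.mul_sum, ← Finset.sum_add_distrib,
      ← Finset.sum_add_distrib]
    exact Finset.sum_congr rfl fun i _ => by ring
  rw [alg.sum_ppart_r_mul_g ht] at e
  linarith

theorem l2_rt_sq_le (T : ℕ) :
    l2 (alg.rt (T + 1)) ^ 2 ≤ l2 (alg.rt 1) ^ 2 + ∑ t ∈ Finset.Icc 1 T, l2 (alg.g t) ^ 2 := by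
  induction T with
  | zero => simp
  | succ T ih =>
    rw [Finset.sum_Icc_succ_top (by omega)]
    linarith [alg.l2_rt_succ_sq_le (t := T + 1) (by omega)]

/-- Progress of the prediction step. -/
theorem stability_le_dotp (hn : 0 < n) {t : ℕ} (ht : 1 ≤ t) :
    1 / (2 * (n : ℝ)) * (l2 (alg.rt t) * l2 (alg.x t - alg.xt t) ^ 2)
      ≤ dotp (alg.x t) (alg.r t - alg.rt t) := by
  by_cases h : alg.rt t = 0
  · rw [(alg.zero_case t ht h).2.2.1, h]
    simp [dotp, l2]
  · have hpos := alg.sum_ppart_r_pos ht h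
    refine (l2_normalize_sub_le hn (ppart_nonneg _) (alg.rt_nonneg ht) hpos
      (alg.sum_rt_pos ht h) rfl rfl (alg.ppart_r_eq ht h) (alg.rt_eq ht h)
      (alg.l2_ppart_r ht)).trans_eq ?_
    refine Finset.sum_congr rfl fun i _ => ?_
    have hx := alg.ppart_r_eq ht h i
    rcases le_total (alg.r t i) 0 with hr | hr
    · have h0 : ppart (alg.r t) i = 0 := max_eq_right hr
      rw [h0, zero_eq_mul] at hx
      rw [hx.resolve_left hpos.ne', zero_mul, zero_mul]
    · rw [ppart, max_eq_left hr, Pi.sub_apply]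

theorem dotp_sub_m {t : ℕ} (ht : 1 ≤ t) {y : Fin n → ℝ} (hy : ∑ i, y i = 1) :
    dotp (y - alg.x t) (alg.m t) = dotp (y - alg.x t) (alg.r t - alg.rt t) := by
  by_cases h : alg.rt t = 0
  · obtain ⟨hm, -, hr, -⟩ := alg.zero_case t ht h
    rw [hm, hr, h, sub_zero]
  · have : ∀ i, (y i - alg.x t i) * alg.m t i = (y i - alg.x t i) * (alg.r t i - alg.rt t i)
        + (alg.gam t * y i - alg.gam t * alg.x t i) := fun i => by
      rw [alg.r_def t ht h]
      simp only [Pi.sub_apply, Pi.add_apply, Pi.smul_apply, Pi.one_apply, smul_eq_mul]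
      ring
    simp only [dotp, Pi.sub_apply, this, Finset.sum_add_distrib, Finset.sum_sub_distrib,
      ← Finset.mul_sum, hy, alg.sum_x ht]
    ring

theorem instant_regret_le {t : ℕ} (ht : 1 ≤ t) {y : Fin n → ℝ}
    (hy : y ∈ stdSimplex ℝ (Fin n)) :
    dotp (y - alg.x t) (alg.u t) ≤
      dotp y (alg.rt (t + 1)) - dotp y (alg.rt t) - dotp (alg.x t) (alg.r t - alg.rt t) := by
  have split : dotp (y - alg.x t) (alg.u t)
      = dotp (y - alg.x t) (alg.m t) + dotp (y - alg.x t) (alg.u t - alg.m t) := by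
    simp only [dotp, Pi.sub_apply, ← Finset.sum_add_distrib]
    exact Finset.sum_congr rfl fun i _ => by ring
  rw [split, alg.dotp_sub_m ht hy.2, ← alg.dotp_g ht hy.2]
  simp only [dotp, ← Finset.sum_add_distrib, ← Finset.sum_sub_distrib]
  refine Finset.sum_le_sum fun i _ => ?_
  have hstep : alg.r t i + alg.g t i ≤ alg.rt (t + 1) i := by
    rw [alg.rt_succ t ht]
    exact le_max_left _ _
  have := mul_le_mul_of_nonneg_left hstep (hy.1 i)
  simp only [Pi.sub_apply]
  linarith

theorem regret_le (hn : 0 < n) (T : ℕ) {y : Fin n → ℝ} (hy : y ∈ stdSimplex ℝ (Fin n)) :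
    ∑ t ∈ Finset.Icc 1 T, dotp (y - alg.x t) (alg.u t) ≤
      dotp y (alg.rt (T + 1)) - dotp y (alg.rt 1) - 1 / (2 * (n : ℝ)) *
        ∑ t ∈ Finset.Icc 1 T, l2 (alg.rt t) * l2 (alg.x t - alg.xt t) ^ 2 := by
  induction T with
  | zero => simp
  | succ T ih =>
    rw [Finset.sum_Icc_succ_top (by omega), Finset.sum_Icc_succ_top (by omega), mul_add]
    linarith [alg.instant_regret_le (t := T + 1) (by omega) hy,
      alg.stability_le_dotp hn (t := T + 1) (by omega)]

end IRPRMp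

theorem dotp_le_l2_of_mem_stdSimplex {n : ℕ} {y : Fin n → ℝ} (hy : y ∈ stdSimplex ℝ (Fin n))
    (v : Fin n → ℝ) : dotp y v ≤ l2 v := by
  refine Real.le_sqrt_of_sq_le ((Finset.sum_mul_sq_le_sq_mul_sq Finset.univ y v).trans ?_)
  refine mul_le_of_le_one_left (Finset.sum_nonneg fun i _ => sq_nonneg _) ?_
  calc ∑ i, y i ^ 2 ≤ (∑ i, y i) ^ 2 := Finset.sum_sq_le_sq_sum_of_nonneg fun i _ => hy.1 i
    _ = 1 := by rw [hy.2, one_pow]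

/-- RVU-type regret bound for IR-PRM⁺ on the simplex. -/
theorem stmt11 {n : ℕ} (alg : IRPRMp n) (T : ℕ) (hT : 1 ≤ T) :
    sSup ((fun xs : Fin n → ℝ =>
        ∑ t ∈ Finset.Icc 1 T, dotp (xs - alg.x t) (alg.u t)) '' stdSimplex ℝ (Fin n))
      ≤ Real.sqrt ((l2 (alg.rt 1)) ^ 2 + ∑ t ∈ Finset.Icc 1 T, (l2 (alg.g t)) ^ 2)
        - (1 / (2 * (n : ℝ))) *
            ∑ t ∈ Finset.Icc 1 T, l2 (alg.rt t) * (l2 (alg.x t - alg.xt t)) ^ 2 := by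
  rcases Nat.eq_zero_or_pos n with rfl | hn
  · simp [Real.sqrt_nonneg, stdSimplex]
  · have : Nonempty (Fin n) := ⟨⟨0, hn⟩⟩
    refine csSup_le ((Set.nonempty_coe_sort.mp inferInstance).image _) ?_
    rintro _ ⟨y, hy, rfl⟩
    have hlast : dotp y (alg.rt (T + 1)) ≤
        Real.sqrt ((l2 (alg.rt 1)) ^ 2 + ∑ t ∈ Finset.Icc 1 T, (l2 (alg.g t)) ^ 2) :=
      (dotp_le_l2_of_mem_stdSimplex hy _).trans (Real.le_sqrt_of_sq_le (alg.l2_rt_sq_le T))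
    have hfirst : 0 ≤ dotp y (alg.rt 1) :=
      Finset.sum_nonneg fun i _ => mul_nonneg (hy.1 i) (alg.rt1_nonneg i)
    have hreg := alg.regret_le hn T hy
    dsimp only
    linarith
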